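/- arXiv:2404.19517 — 2 statements merged into one kernel-verified Lean document; each statement's English description precedes it below -/
import Mathlib

section
/- Let f : ℝ^p → ℝ be continuously differentiable, let ε ≥ 0, and let x be an ε-biased gradient curve of f on [0,∞). Then either ‖x(t)‖ → +∞ as t → ∞, or the following two assertions both hold: liminf_{t→∞} ‖∇f(x(t))‖ ≤ ε, and lim_{t→∞} dist(f(x(t)), vcrit_ε f) = 0. -/
open Filter MeasureTheory Metric Set Topology
open scoped ENNReal NNReal

abbrev Ep (p : ℕ) := EuclideanSpace ℝ (Fin p)

def critSet {p : ℕ} (f : Ep p → ℝ) (ε : ℝ) : Set (Ep p) := {x | ‖gradient f x‖ ≤ ε}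

def vcritSet {p : ℕ} (f : Ep p → ℝ) (ε : ℝ) : Set ℝ := f '' critSet f ε

/-- An `ε`-biased gradient curve of `f` on the interval `I ⊆ [0,∞)`: a locally Lipschitz
curve on `I` which is differentiable a.e. on `I` with `‖x'(t) + ∇f(x(t))‖ ≤ ε`. -/
def IsBiasedGradCurve {p : ℕ} (f : Ep p → ℝ) (ε : ℝ) (I : Set ℝ) (x : ℝ → Ep p) : Prop :=
  (∀ t ∈ I, ∃ K : NNReal, ∃ s ∈ nhdsWithin t I, LipschitzOnWith K x s) ∧
  ∀ᵐ t ∂(volume.restrict I), DifferentiableAt ℝ x t ∧ ‖deriv x t + gradient f (x t)‖ ≤ ε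

theorem LocallyLipschitz.comp_locallyLipschitzOn {α β γ : Type*} [PseudoEMetricSpace α]
    [PseudoEMetricSpace β] [PseudoEMetricSpace γ] {g : β → γ} {h : α → β} {s : Set α}
    (hg : LocallyLipschitz g) (hh : LocallyLipschitzOn s h) :
    LocallyLipschitzOn s (g ∘ h) := by
  intro t ht
  obtain ⟨K, u, hu, hK⟩ := hh ht
  obtain ⟨L, v, hv, hL⟩ := hg (h t)
  exact ⟨L * K, u ∩ h ⁻¹' v, inter_mem hu (hh.continuousOn t ht hv),
    hL.comp (hK.mono inter_subset_left) fun _ hz => hz.2⟩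

theorem LocallyLipschitzOn.sub_le_of_ae_deriv_le {h : ℝ → ℝ} {a b C : ℝ} (hab : a ≤ b)
    (hh : LocallyLipschitzOn (Icc a b) h)
    (hC : ∀ᵐ t ∂(volume.restrict (Ioo a b)), deriv h t ≤ C) :
    h b - h a ≤ C * (b - a) := by
  obtain ⟨K, hK⟩ := hh.exists_lipschitzOnWith_of_compact isCompact_Icc
  rw [← uIcc_of_le hab] at hK
  have hac := hK.absolutelyContinuousOnInterval
  have hint := hac.intervalIntegrable_deriv
  rw [← hac.integral_deriv_eq_sub]
  calc ∫ t in a..b, deriv h t ≤ ∫ _ in a..b, C := by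
        rw [intervalIntegral.integral_of_le hab, intervalIntegral.integral_of_le hab,
          integral_Ioc_eq_integral_Ioo, integral_Ioc_eq_integral_Ioo]
        exact setIntegral_mono_ae_restrict (hint.1.mono_set Ioo_subset_Ioc_self)
          (by simp) hC
    _ = C * (b - a) := by simp [mul_comm]

namespace IsBiasedGradCurve

variable {p : ℕ} {f : Ep p → ℝ} {ε : ℝ} {x : ℝ → Ep p}

theorem locallyLipschitzOn {I : Set ℝ} (hx : IsBiasedGradCurve f ε I x) :
    LocallyLipschitzOn I x := hx.1

theorem ae_Ioo {a b : ℝ} (hx : IsBiasedGradCurve f ε (Ici 0) x) (ha : 0 ≤ a) :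
    ∀ᵐ t ∂(volume.restrict (Ioo a b)), t ∈ Ioo a b ∧ DifferentiableAt ℝ x t ∧
      ‖deriv x t + gradient f (x t)‖ ≤ ε := by
  filter_upwards [ae_restrict_mem measurableSet_Ioo,
    ae_restrict_of_ae_restrict_of_subset (fun t ht => ha.trans ht.1.le) hx.2] with t h1 h2
  exact ⟨h1, h2⟩

theorem continuousOn_comp (hf : ContDiff ℝ 1 f) (hx : IsBiasedGradCurve f ε (Ici 0) x) :
    ContinuousOn (fun t => f (x t)) (Ici 0) :=
  hf.continuous.comp_continuousOn hx.locallyLipschitzOn.continuousOn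

/-- The objective decreases at rate at least `δ ^ 2` where the gradient has norm `≥ ε + δ`. -/
theorem sub_le_of_le_norm_gradient (hf : ContDiff ℝ 1 f) (hε : 0 ≤ ε)
    (hx : IsBiasedGradCurve f ε (Ici 0) x) {a b δ : ℝ} (ha : 0 ≤ a) (hab : a ≤ b) (hδ : 0 ≤ δ)
    (hg : ∀ t ∈ Ioo a b, ε + δ ≤ ‖gradient f (x t)‖) :
    f (x b) - f (x a) ≤ -δ ^ 2 * (b - a) := by
  refine LocallyLipschitzOn.sub_le_of_ae_deriv_le (h := f ∘ x) hab
    ((hf.locallyLipschitz.comp_locallyLipschitzOn hx.locallyLipschitzOn).mono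
      fun t ht => ha.trans ht.1) ?_
  filter_upwards [hx.ae_Ioo ha] with t ⟨ht, hd, hb⟩
  have hderiv : deriv (f ∘ x) t = inner ℝ (gradient f (x t)) (deriv x t) := by
    rw [inner_gradient_left]
    exact fderiv_comp_deriv t ((hf.differentiable one_ne_zero) (x t)) hd
  have hcs := real_inner_le_norm (gradient f (x t)) (deriv x t + gradient f (x t))
  rw [inner_add_right, real_inner_self_eq_norm_sq] at hcs
  have hmul := mul_le_mul_of_nonneg_left hb (norm_nonneg (gradient f (x t)))
  rw [hderiv]
  nlinarith [hg t ht]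

/-- Gaps between critical values can only be crossed downwards. -/
theorem le_of_disjoint_vcritSet (hf : ContDiff ℝ 1 f) (hε : 0 ≤ ε)
    (hx : IsBiasedGradCurve f ε (Ici 0) x) {a b c d : ℝ} (ha : 0 ≤ a) (hab : a ≤ b)
    (hcd : c < d) (hgap : ∀ v ∈ Ioo c d, v ∉ vcritSet f ε) (hac : f (x a) ≤ c) :
    f (x b) ≤ c := by
  by_contra! hb
  have hcont : ContinuousOn (fun t => f (x t)) (Icc a b) :=
    (hx.continuousOn_comp hf).mono fun t ht => ha.trans ht.1
  have hcomp : IsCompact (Icc a b ∩ (fun t => f (x t)) ⁻¹' Iic c) :=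
    isCompact_Icc.of_isClosed_subset (hcont.preimage_isClosed_of_isClosed isClosed_Icc isClosed_Iic)
      inter_subset_left
  obtain ⟨s, ⟨hs, hsc : f (x s) ≤ c⟩, hmax⟩ :=
    hcomp.exists_isGreatest ⟨a, left_mem_Icc.2 hab, hac⟩
  have hs0 : 0 ≤ s := ha.trans hs.1
  have hsb : s < b := lt_of_le_of_ne hs.2 fun h => by rw [h] at hsc; exact hsc.not_gt hb
  have habove : ∀ t ∈ Ioc s b, c < f (x t) := fun t ht => by
    by_contra! h
    exact ht.1.not_ge (hmax ⟨⟨hs.1.trans ht.1.le, ht.2⟩, h⟩)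
  have hnhds : ∀ᶠ t in 𝓝[>] s, f (x t) < d :=
    ((hx.continuousOn_comp hf).continuousWithinAt hs0).mono
      (fun t ht => hs0.trans (le_of_lt ht)) |>.eventually_lt_const (hsc.trans_lt hcd)
  obtain ⟨u, hu, hsub⟩ := (mem_nhdsGT_iff_exists_Ioc_subset).1 hnhds
  have hsu : s < min u b := lt_min hu hsb
  have hdec := hx.sub_le_of_le_norm_gradient hf hε (b := min u b) hs0 hsu.le le_rfl
    fun t ht => by
      have h2 : t < u ∧ t < b := lt_min_iff.1 ht.2
      rw [add_zero]
      by_contra! h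
      exact hgap _ ⟨habove t ⟨ht.1, h2.2.le⟩, hsub ⟨ht.1, h2.1.le⟩⟩ ⟨x t, h.le, rfl⟩
  have := habove (min u b) ⟨hsu, min_le_right _ _⟩
  linarith

theorem norm_sub_lt_one {M : ℝ} (hx : IsBiasedGradCurve f ε (Ici 0) x) {a b : ℝ}
    (ha : 0 ≤ a) (hab : a ≤ b)
    (hM : ∀ y, ‖y - x a‖ ≤ 1 → ‖gradient f y‖ + ε ≤ M) (hM0 : 0 ≤ M) (hlt : M * (b - a) < 1) :
    ‖x b - x a‖ < 1 := by
  by_contra! hb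
  have hcont : ContinuousOn (fun t => ‖x t - x a‖) (Icc a b) :=
    ((hx.locallyLipschitzOn.continuousOn.mono fun t ht => ha.trans ht.1).sub
      continuousOn_const).norm
  have hcomp : IsCompact (Icc a b ∩ (fun t => ‖x t - x a‖) ⁻¹' Ici 1) :=
    isCompact_Icc.of_isClosed_subset (hcont.preimage_isClosed_of_isClosed isClosed_Icc isClosed_Ici)
      inter_subset_left
  obtain ⟨u, ⟨hu, hu1 : 1 ≤ ‖x u - x a‖⟩, hmin⟩ :=
    hcomp.exists_isLeast ⟨b, right_mem_Icc.2 hab, hb⟩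
  have hbelow : ∀ t ∈ Ioo a u, ‖x t - x a‖ ≤ 1 := fun t ht => by
    by_contra! h
    exact ht.2.not_ge (hmin ⟨⟨ht.1.le, ht.2.le.trans hu.2⟩, h.le⟩)
  set v := x u - x a
  have key := LocallyLipschitzOn.sub_le_of_ae_deriv_le (h := innerSL ℝ v ∘ x) (C := ‖v‖ * M) hu.1
    (((innerSL ℝ v).lipschitz.locallyLipschitz.comp_locallyLipschitzOn
      hx.locallyLipschitzOn).mono fun t ht => ha.trans ht.1) (by
      filter_upwards [hx.ae_Ioo ha] with t ⟨ht, hd, hb⟩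
      have hderiv : deriv (innerSL ℝ v ∘ x) t = inner ℝ v (deriv x t) :=
        ((innerSL ℝ v).hasFDerivAt.comp_hasDerivAt t hd.hasDerivAt).deriv
      rw [hderiv]
      refine (real_inner_le_norm _ _).trans (mul_le_mul_of_nonneg_left ?_ (norm_nonneg _))
      have h1 := norm_sub_le (deriv x t + gradient f (x t)) (gradient f (x t))
      rw [add_sub_cancel_right] at h1
      linarith [hM _ (hbelow t ht)])
  have hsq : (innerSL ℝ v ∘ x) u - (innerSL ℝ v ∘ x) a = ‖v‖ ^ 2 := by
    rw [← real_inner_self_eq_norm_sq, Function.comp_apply, Function.comp_apply, ← map_sub,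
      innerSL_apply_apply]
  rw [hsq] at key
  have hub : M * (u - a) ≤ M * (b - a) := by gcongr; exact hu.2
  nlinarith

theorem liminf_norm_gradient_le (hf : ContDiff ℝ 1 f) (hε : 0 ≤ ε)
    (hx : IsBiasedGradCurve f ε (Ici 0) x) {m : ℝ} (hm : ∃ᶠ t in atTop, m ≤ f (x t)) :
    liminf (fun t => ‖gradient f (x t)‖) atTop ≤ ε := by
  by_contra! h
  obtain ⟨g, hεg, hg⟩ := exists_between h
  have hev := eventually_lt_of_lt_liminf hg
    (isBoundedUnder_of ⟨0, fun t => norm_nonneg (gradient f (x t))⟩)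
  obtain ⟨T, hT⟩ := eventually_atTop.1 (hev.and (eventually_ge_atTop 0))
  have hT0 : 0 ≤ T := (hT T le_rfl).2
  have hpos : 0 < (g - ε) ^ 2 := by have := sub_pos.2 hεg; positivity
  have hlim : Tendsto (fun t => (g - ε) ^ 2 * (t - T)) atTop atTop :=
    (tendsto_atTop_add_const_right _ (-T) tendsto_id).const_mul_atTop hpos
  obtain ⟨t, hmt, hgt, hTt⟩ := (hm.and_eventually
    ((hlim.eventually_gt_atTop (f (x T) - m)).and (eventually_ge_atTop T))).exists
  have := hx.sub_le_of_le_norm_gradient hf hε hT0 hTt (sub_pos.2 hεg).le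
    fun s hs => by linarith [(hT s hs.1.le).1]
  linarith

/-- A curve returning to a bounded set cannot have values converging to a limit isolated from
the critical values. -/
theorem not_tendsto_of_disjoint_vcritSet (hf : ContDiff ℝ 1 f) (hε : 0 ≤ ε)
    (hx : IsBiasedGradCurve f ε (Ici 0) x) {R c η : ℝ} (hR : ∃ᶠ t in atTop, ‖x t‖ ≤ R)
    (hη : 0 < η) (hgap : ∀ v ∈ closedBall c η, v ∉ vcritSet f ε) :
    ¬ Tendsto (fun t => f (x t)) atTop (𝓝 c) := by
  intro hlim
  have hgrad : Continuous fun y => ‖gradient f y‖ :=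
    ((InnerProductSpace.toDual ℝ (Ep p)).symm.continuous.comp
      (hf.continuous_fderiv one_ne_zero)).norm
  have hball : IsCompact (closedBall (0 : Ep p) (R + 1)) := isCompact_closedBall _ _
  obtain ⟨M, hM⟩ := hball.bddAbove_image hgrad.continuousOn
  have hK : IsCompact (closedBall (0 : Ep p) (R + 1) ∩ f ⁻¹' closedBall c η) :=
    hball.inter_right (isClosed_closedBall.preimage hf.continuous)
  obtain ⟨δ, hδ, hKδ⟩ : ∃ δ > 0, ∀ y ∈ closedBall (0 : Ep p) (R + 1) ∩ f ⁻¹' closedBall c η,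
      ε + δ ≤ ‖gradient f y‖ := by
    rcases (closedBall (0 : Ep p) (R + 1) ∩ f ⁻¹' closedBall c η).eq_empty_or_nonempty with h | h
    · exact ⟨1, one_pos, by simp [h]⟩
    · obtain ⟨z, hz, hmin⟩ := hK.exists_isMinOn h hgrad.continuousOn
      refine ⟨‖gradient f z‖ - ε, sub_pos.2 ?_, fun y hy => ?_⟩
      · by_contra! hle
        exact hgap _ hz.2 ⟨z, hle, rfl⟩
      · simpa using hmin hy
  have hM1 : 0 ≤ |M| + ε := by positivity
  obtain ⟨τ, hτ, hτM⟩ : ∃ τ > 0, (|M| + ε) * τ < 1 := by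
    refine ⟨1 / (|M| + ε + 1), by positivity, ?_⟩
    rw [mul_one_div, div_lt_one (by positivity)]
    linarith
  have hκ : 0 < min η (δ ^ 2 * τ / 3) := by positivity
  obtain ⟨T, hT⟩ := eventually_atTop.1
    ((hlim.eventually (closedBall_mem_nhds c hκ)).and (eventually_ge_atTop 0))
  obtain ⟨t, hxt, hTt⟩ := (hR.and_eventually (eventually_ge_atTop T)).exists
  have ht0 : 0 ≤ t := (hT t hTt).2
  have hclose : ∀ s, T ≤ s → |f (x s) - c| ≤ min η (δ ^ 2 * τ / 3) := fun s hs => by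
    simpa [Real.dist_eq] using (hT s hs).1
  have hnear : ∀ y, ‖y - x t‖ ≤ 1 → y ∈ closedBall (0 : Ep p) (R + 1) := fun y hy => by
    rw [mem_closedBall_zero_iff]
    have := norm_add_le (y - x t) (x t)
    rw [sub_add_cancel] at this
    linarith
  have hdec := hx.sub_le_of_le_norm_gradient hf hε (b := t + τ) ht0 (by linarith) hδ.le
    fun s hs => by
      refine hKδ _ ⟨hnear _ (hx.norm_sub_lt_one (M := |M| + ε) ht0 hs.1.le (fun y hy => ?_)
        hM1 ?_).le, ?_⟩
      · have := hM (mem_image_of_mem _ (hnear y hy))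
        linarith [le_abs_self M]
      · refine lt_of_le_of_lt (mul_le_mul_of_nonneg_left ?_ hM1) hτM
        linarith [hs.2]
      · simpa [Real.dist_eq] using (hclose s (hTt.trans hs.1.le)).trans (min_le_left _ _)
  rw [add_sub_cancel_left] at hdec
  have h1 := abs_le.1 ((hclose t hTt).trans (min_le_right _ _))
  have h2 := abs_le.1 ((hclose (t + τ) (by linarith)).trans (min_le_right _ _))
  have hpos : 0 < δ ^ 2 * τ := by positivity
  linarith

theorem tendsto_infDist_vcritSet (hf : ContDiff ℝ 1 f) (hε : 0 ≤ ε)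
    (hx : IsBiasedGradCurve f ε (Ici 0) x) {R : ℝ} (hR : ∃ᶠ t in atTop, ‖x t‖ ≤ R) {m : ℝ}
    (hm : ∃ᶠ t in atTop, m ≤ f (x t)) :
    Tendsto (fun t => infDist (f (x t)) (vcritSet f ε)) atTop (𝓝 0) := by
  by_contra hnot
  obtain ⟨η, hη, hfreq⟩ : ∃ η > 0, ∃ᶠ t in atTop, η ≤ infDist (f (x t)) (vcritSet f ε) := by
    simpa [Metric.tendsto_nhds, Real.dist_eq, abs_of_nonneg infDist_nonneg, frequently_atTop]
      using hnot
  have hgap : ∀ c, η ≤ infDist c (vcritSet f ε) → ∀ v, |v - c| < η → v ∉ vcritSet f ε :=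
    fun c hc v hv hmem => by
      have := infDist_le_dist_of_mem (x := c) hmem
      rw [dist_comm, Real.dist_eq] at this
      linarith
  set C := {c | ∃ t, 0 ≤ t ∧ f (x t) = c ∧ η ≤ infDist c (vcritSet f ε)}
  have hub : ∀ c ∈ C, ∀ᶠ t in atTop, f (x t) ≤ c := by
    rintro c ⟨t, ht, rfl, hc⟩
    filter_upwards [eventually_ge_atTop t] with s hs
    refine hx.le_of_disjoint_vcritSet hf hε ht hs (lt_add_of_pos_right _ hη) (fun v hv => ?_) le_rfl
    exact hgap _ hc v (abs_lt.2 ⟨by linarith [hv.1], by linarith [hv.2]⟩)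
  have hne : C.Nonempty := by
    obtain ⟨t, h1, h2⟩ := (hfreq.and_eventually (eventually_ge_atTop 0)).exists
    exact ⟨_, t, h2, rfl, h1⟩
  have hbdd : BddBelow C := ⟨m, fun c hc => by
    obtain ⟨t, h1, h2⟩ := (hm.and_eventually (hub c hc)).exists
    exact h1.trans h2⟩
  have hinf : η ≤ infDist (sInf C) (vcritSet f ε) := by
    have hclosed : IsClosed {c : ℝ | η ≤ infDist c (vcritSet f ε)} :=
      isClosed_le continuous_const (continuous_infDist_pt _)
    have hsub : C ⊆ {c : ℝ | η ≤ infDist c (vcritSet f ε)} := fun c ⟨_, _, _, h⟩ => h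
    exact closure_minimal hsub hclosed (csInf_mem_closure hne hbdd)
  have hlb : ∀ t, 0 ≤ t → sInf C ≤ f (x t) := fun t ht => by
    by_contra! hlt
    have hmax : max (f (x t)) (sInf C - η / 2) < sInf C := max_lt hlt (by linarith)
    obtain ⟨s, h1, h2⟩ := (hfreq.and_eventually (eventually_ge_atTop t)).exists
    have hs := hx.le_of_disjoint_vcritSet hf hε ht h2 hmax (fun v hv => hgap _ hinf v
      (abs_lt.2 ⟨by linarith [hv.1, le_max_right (f (x t)) (sInf C - η / 2)],
        by linarith [hv.2]⟩)) (le_max_left _ _)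
    have := csInf_le hbdd ⟨s, ht.trans h2, rfl, h1⟩
    linarith
  refine hx.not_tendsto_of_disjoint_vcritSet hf hε hR (half_pos hη) (c := sInf C)
    (fun v hv => hgap _ hinf v ?_) ?_
  · rw [mem_closedBall, Real.dist_eq] at hv
    linarith
  · refine tendsto_order.2 ⟨fun a ha => ?_, fun a ha => ?_⟩
    · filter_upwards [eventually_ge_atTop 0] with t ht using ha.trans_le (hlb t ht)
    · obtain ⟨c, hc, hca⟩ := exists_lt_of_csInf_lt hne ha
      filter_upwards [hub c hc] with t ht using ht.trans_lt hca

end IsBiasedGradCurve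

theorem stmt2 {p : ℕ} (f : Ep p → ℝ) (hf : ContDiff ℝ 1 f)
    (ε : ℝ) (hε : 0 ≤ ε) (x : ℝ → Ep p)
    (hx : IsBiasedGradCurve f ε (Set.Ici 0) x) :
    Tendsto (fun t : ℝ => ‖x t‖) atTop atTop ∨
      (Filter.liminf (fun t : ℝ => ‖gradient f (x t)‖) atTop ≤ ε ∧
        Tendsto (fun t : ℝ => infDist (f (x t)) (vcritSet f ε)) atTop (nhds 0)) := by
  refine or_iff_not_imp_left.2 fun hnot => ?_
  obtain ⟨R, hR⟩ : ∃ R, ∃ᶠ t in atTop, ‖x t‖ ≤ R := by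
    by_contra! h
    exact hnot (tendsto_atTop.2 fun R => (h R).mono fun _ ht => ht.le)
  obtain ⟨m, hm⟩ := (isCompact_closedBall (0 : Ep p) R).bddBelow_image hf.continuous.continuousOn
  have hfreq : ∃ᶠ t in atTop, m ≤ f (x t) :=
    hR.mono fun t ht => hm (mem_image_of_mem f (mem_closedBall_zero_iff.2 ht))
  exact ⟨hx.liminf_norm_gradient_le hf hε hfreq, hx.tendsto_infDist_vcritSet hf hε hR hfreq⟩
end

section
/- Let f : ℝ^p → ℝ be continuously differentiable, let ε > 0, and let l ∉ vcrit_ε f. Then for every η > 0 and M > 0 there exists ᾱ > 0 such that: for every z ∈ ℝ^p with f(z) ≤ l and ‖z‖ ≤ M, and every ε-biased gradient sequence (x_k) with x_0 = z and step sizes 0 < α_k ≤ ᾱ for all k, one has f(x_k) ≤ l + η for every index k such that ‖x_i‖ ≤ M for all i ≤ k. Moreover, if f is coercive (all sublevel sets of f are compact), then there exist M > 0 and ᾱ > 0 such that every ε-biased gradient sequence with f(x_0) ≤ l and step sizes 0 < α_k ≤ ᾱ satisfies ‖x_k‖ ≤ M for all k ∈ ℕ. -/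
open Filter MeasureTheory Metric Set Topology
open scoped ENNReal NNReal

/-- An `ε`-biased gradient sequence with step sizes `αs`: `x (k+1) = x k - αs k • v k` where
`‖v k - ∇f (x k)‖ ≤ ε`. -/
def IsBiasedGradSeq {p : ℕ} (f : Ep p → ℝ) (ε : ℝ) (αs : ℕ → ℝ) (x : ℕ → Ep p) : Prop :=
  ∃ v : ℕ → Ep p, ∀ k : ℕ, ‖v k - gradient f (x k)‖ ≤ ε ∧ x (k + 1) = x k - αs k • v k

theorem ContDiff.continuous_gradient {p : ℕ} {f : Ep p → ℝ} (hf : ContDiff ℝ 1 f) :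
    Continuous (gradient f) :=
  (InnerProductSpace.toDual ℝ (Ep p)).symm.continuous.comp (hf.continuous_fderiv one_ne_zero)

theorem exists_norm_gradient_le {p : ℕ} {f : Ep p → ℝ} (hf : ContDiff ℝ 1 f) (M : ℝ) :
    ∃ L : ℝ, 0 < L ∧ ∀ x : Ep p, ‖x‖ ≤ M → ‖gradient f x‖ ≤ L := by
  obtain ⟨L, hL⟩ := (isCompact_closedBall (0 : Ep p) M).exists_bound_of_continuousOn
    hf.continuous_gradient.continuousOn
  exact ⟨max L 1, by positivity,
    fun x hx => (hL x (by simpa using hx)).trans (le_max_left _ _)⟩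

/-- On a ball, the gradient norm exceeds `ε` by a uniform margin on a band around a value `l`
which is not `ε`-critical. -/
theorem exists_gradient_margin {p : ℕ} {f : Ep p → ℝ} (hf : ContDiff ℝ 1 f) {ε l : ℝ}
    (hl : l ∉ vcritSet f ε) (M : ℝ) :
    ∃ c : ℝ, 0 < c ∧ ∀ x : Ep p, ‖x‖ ≤ M → |f x - l| < c → ε + c ≤ ‖gradient f x‖ := by
  have hcont : Continuous fun x => max (‖gradient f x‖ - ε) |f x - l| :=
    (hf.continuous_gradient.norm.sub continuous_const).max
      (hf.continuous.sub continuous_const).abs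
  have hpos : ∀ x ∈ closedBall (0 : Ep p) M, 0 < max (‖gradient f x‖ - ε) |f x - l| := by
    intro x _
    by_cases h : f x = l
    · have : ¬ ‖gradient f x‖ ≤ ε := fun hx => hl ⟨x, hx, h⟩
      exact lt_max_of_lt_left (by linarith)
    · exact lt_max_of_lt_right (abs_pos.2 (sub_ne_zero.2 h))
  obtain ⟨c, hc, hmin⟩ :=
    (isCompact_closedBall (0 : Ep p) M).exists_forall_le' hcont.continuousOn hpos
  refine ⟨c, hc, fun x hx hxl => ?_⟩
  rcases le_max_iff.1 (hmin x (by simpa using hx)) with h | h <;> linarith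

/-- First-order expansion of `f` on a ball, with a uniformly small remainder. -/
theorem exists_gradient_expansion {p : ℕ} {f : Ep p → ℝ} (hf : ContDiff ℝ 1 f) (M : ℝ)
    {ω : ℝ} (hω : 0 < ω) :
    ∃ r : ℝ, 0 < r ∧ ∀ x y : Ep p, ‖x‖ ≤ M → ‖y‖ ≤ M → ‖y - x‖ ≤ r →
      f y - f x ≤ inner ℝ (gradient f x) (y - x) + ω * ‖y - x‖ := by
  have huc := (isCompact_closedBall (0 : Ep p) M).uniformContinuousOn_of_continuous
    (hf.continuous_fderiv one_ne_zero).continuousOn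
  obtain ⟨r, hr, hfd⟩ := Metric.uniformContinuousOn_iff.1 huc ω hω
  refine ⟨r / 2, half_pos hr, fun x y hx hy hxy => ?_⟩
  have hdiff : Differentiable ℝ f := hf.differentiable one_ne_zero
  have hx0 : x ∈ closedBall (0 : Ep p) M := by simpa using hx
  have h := ((convex_closedBall (0 : Ep p) M).inter
    (convex_closedBall x (r / 2))).norm_image_sub_le_of_norm_hasFDerivWithin_le'
    (f := f) (f' := fderiv ℝ f) (φ := fderiv ℝ f x) (C := ω) (x := x) (y := y)
    (fun z _ => (hdiff z).hasFDerivAt.hasFDerivWithinAt)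
    (fun z hz => by
      rw [← dist_eq_norm]
      exact (hfd z hz.1 x hx0 ((mem_closedBall.1 hz.2).trans_lt (half_lt_self hr))).le)
    ⟨hx0, mem_closedBall_self (half_pos hr).le⟩
    ⟨by simpa using hy, by simpa [dist_eq_norm] using hxy⟩
  have hinner : inner ℝ (gradient f x) (y - x) = fderiv ℝ f x (y - x) := by
    simp [gradient]
  rw [hinner]
  linarith [le_abs_self (f y - f x - fderiv ℝ f x (y - x)), Real.norm_eq_abs
    (f y - f x - fderiv ℝ f x (y - x))]

theorem norm_biased_step_le {E : Type*} [NormedAddCommGroup E] [NormedSpace ℝ E] {g v : E}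
    {ε L α : ℝ} (hv : ‖v - g‖ ≤ ε) (hg : ‖g‖ ≤ L) (hα : 0 ≤ α) :
    ‖α • v‖ ≤ α * (L + ε) := by
  rw [norm_smul, Real.norm_of_nonneg hα]
  gcongr
  linarith [norm_le_norm_add_norm_sub' v g]

theorem mul_le_inner_biased {E : Type*} [NormedAddCommGroup E] [InnerProductSpace ℝ E] {g v : E}
    {ε c : ℝ} (hε : 0 ≤ ε) (hc : 0 ≤ c) (hv : ‖v - g‖ ≤ ε) (hg : ε + c ≤ ‖g‖) :
    ε * c ≤ inner ℝ g v := by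
  have h1 : inner ℝ g v = ‖g‖ ^ 2 + inner ℝ g (v - g) := by
    rw [inner_sub_right, real_inner_self_eq_norm_sq]; ring
  have h2 : -(‖g‖ * ε) ≤ inner ℝ g (v - g) :=
    (neg_le_neg (mul_le_mul_of_nonneg_left hv (norm_nonneg g))).trans
      (neg_le_of_abs_le (abs_real_inner_le_norm g (v - g)))
  nlinarith

/-- A biased gradient sequence with small steps cannot climb above a level which is not
`ε`-critical while it stays in a given ball. -/
theorem exists_stepsize_value_le {p : ℕ} {f : Ep p → ℝ} (hf : ContDiff ℝ 1 f)
    {ε : ℝ} (hε : 0 < ε) {l : ℝ} (hl : l ∉ vcritSet f ε) {η : ℝ} (hη : 0 < η) (M : ℝ) :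
    ∃ a : ℝ, 0 < a ∧ ∀ (αs : ℕ → ℝ) (x : ℕ → Ep p), f (x 0) ≤ l →
      (∀ k, 0 < αs k ∧ αs k ≤ a) → IsBiasedGradSeq f ε αs x →
      ∀ k, (∀ i ≤ k, ‖x i‖ ≤ M) → f (x k) ≤ l + η := by
  obtain ⟨L, hL, hgrad⟩ := exists_norm_gradient_le hf M
  obtain ⟨c, hc, hmargin⟩ := exists_gradient_margin hf hl M
  have hLε : 0 < L + ε := by positivity
  set ω := ε * c / (L + ε) with hωdef
  have hω : 0 < ω := by positivity
  obtain ⟨r, hr, hexp⟩ := exists_gradient_expansion hf M hω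
  set δ := min η (c / 2) with hδdef
  have hδ : 0 < δ := by positivity
  have hδc : δ < c := (min_le_right _ _).trans_lt (half_lt_self hc)
  refine ⟨min (r / (L + ε)) (δ / ((L + ω) * (L + ε))), by positivity, ?_⟩
  rintro αs x hx0 hα ⟨v, hv⟩ k hk
  suffices h : f (x k) ≤ l + δ from h.trans (by gcongr; exact min_le_left _ _)
  induction k with
  | zero => linarith
  | succ k ih =>
    have hfk := ih fun i hi => hk i (hi.trans k.le_succ)
    have hxk := hk k k.le_succ
    obtain ⟨hα0, hαa⟩ := hα k
    obtain ⟨hvk, hstep⟩ := hv k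
    have hdiff : x (k + 1) - x k = -(αs k • v k) := by rw [hstep]; abel
    have hlen : ‖x (k + 1) - x k‖ ≤ αs k * (L + ε) := by
      rw [hdiff, norm_neg]
      exact norm_biased_step_le hvk (hgrad _ hxk) hα0.le
    have hαr : αs k * (L + ε) ≤ r := (le_div_iff₀ hLε).1 (hαa.trans (min_le_left _ _))
    have hαδ : αs k * ((L + ω) * (L + ε)) ≤ δ :=
      (le_div_iff₀ (by positivity)).1 (hαa.trans (min_le_right _ _))
    have hdesc := hexp _ _ hxk (hk _ le_rfl) (hlen.trans hαr)
    have hrem := mul_le_mul_of_nonneg_left hlen hω.le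
    rcases le_total (f (x k)) l with hlow | hhigh
    · have hinner : inner ℝ (gradient f (x k)) (x (k + 1) - x k) ≤ L * (αs k * (L + ε)) :=
        (real_inner_le_norm _ _).trans
          (mul_le_mul (hgrad _ hxk) hlen (norm_nonneg _) hL.le)
      linarith
    · have hband : |f (x k) - l| < c := by
        rw [abs_of_nonneg (sub_nonneg.2 hhigh)]; linarith
      have hinner := mul_le_inner_biased hε.le hc.le hvk (hmargin _ hxk hband)
      rw [hdiff, inner_neg_right, inner_smul_right, ← hdiff] at hdesc
      have hωL : ω * (αs k * (L + ε)) = αs k * (ε * c) := by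
        rw [hωdef]; field_simp
      linarith [mul_le_mul_of_nonneg_left hinner hα0.le]

/-- For coercive `f`, biased gradient sequences with small steps started below a level which is
not `ε`-critical are uniformly bounded. -/
theorem exists_stepsize_norm_le {p : ℕ} {f : Ep p → ℝ} (hf : ContDiff ℝ 1 f)
    {ε : ℝ} (hε : 0 < ε) {l : ℝ} (hl : l ∉ vcritSet f ε)
    (hcoer : ∀ r : ℝ, IsCompact {y : Ep p | f y ≤ r}) :
    ∃ M a : ℝ, 0 < M ∧ 0 < a ∧ ∀ (αs : ℕ → ℝ) (x : ℕ → Ep p), f (x 0) ≤ l →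
      (∀ k, 0 < αs k ∧ αs k ≤ a) → IsBiasedGradSeq f ε αs x → ∀ k, ‖x k‖ ≤ M := by
  obtain ⟨R, hR0, hR⟩ := (hcoer (l + 1)).isBounded.exists_pos_norm_le
  obtain ⟨L, hL, hgrad⟩ := exists_norm_gradient_le hf (R + 1)
  obtain ⟨a, ha, hval⟩ := exists_stepsize_value_le hf hε hl one_pos (R + 1)
  refine ⟨R + 1, min a (1 / (L + ε)), by positivity, by positivity, ?_⟩
  intro αs x hx0 hα hx k
  have hval' := hval αs x hx0 (fun k => ⟨(hα k).1, (hα k).2.trans (min_le_left _ _)⟩) hx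
  obtain ⟨v, hv⟩ := hx
  induction k using Nat.strong_induction_on with
  | _ k ih =>
    cases k with
    | zero => exact (hR _ (show f (x 0) ≤ l + 1 by linarith)).trans (by linarith)
    | succ k =>
      have hxk := hR _ (hval' k fun i hi => ih i (Nat.lt_succ_of_le hi))
      have hlen := norm_biased_step_le (hv k).1 (hgrad _ (ih k k.lt_succ_self)) (hα k).1.le
      have hα1 : αs k * (L + ε) ≤ 1 :=
        (le_div_iff₀ (by positivity)).1 ((hα k).2.trans (min_le_right _ _))
      rw [(hv k).2]
      linarith [norm_sub_le (x k) (αs k • v k)]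

theorem stmt13 {p : ℕ} (f : Ep p → ℝ) (hf : ContDiff ℝ 1 f)
    (ε : ℝ) (hε : 0 < ε) (l : ℝ) (hl : l ∉ vcritSet f ε) :
    (∀ η M : ℝ, 0 < η → 0 < M →
      ∃ ᾱ : ℝ, 0 < ᾱ ∧
        ∀ (z : Ep p) (αs : ℕ → ℝ) (x : ℕ → Ep p),
          f z ≤ l → ‖z‖ ≤ M → x 0 = z →
          (∀ k : ℕ, 0 < αs k ∧ αs k ≤ ᾱ) →
          IsBiasedGradSeq f ε αs x →
          ∀ k : ℕ, (∀ i ≤ k, ‖x i‖ ≤ M) → f (x k) ≤ l + η) ∧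
    ((∀ r : ℝ, IsCompact {y : Ep p | f y ≤ r}) →
      ∃ M ᾱ : ℝ, 0 < M ∧ 0 < ᾱ ∧
        ∀ (αs : ℕ → ℝ) (x : ℕ → Ep p),
          f (x 0) ≤ l →
          (∀ k : ℕ, 0 < αs k ∧ αs k ≤ ᾱ) →
          IsBiasedGradSeq f ε αs x →
          ∀ k : ℕ, ‖x k‖ ≤ M) := by
  refine ⟨fun η M hη _ => ?_, exists_stepsize_norm_le hf hε hl⟩
  obtain ⟨a, ha, h⟩ := exists_stepsize_value_le hf hε hl hη M
  exact ⟨a, ha, fun z αs x hz _ hx0 => h αs x (hx0 ▸ hz)⟩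
end
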